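/- arXiv:2506.04857 — 8 statements merged into one kernel-verified Lean document; each statement's English description precedes it below -/
import Mathlib

section
/- For any adiabatic index γ > 1, the MHD pressure function p is concave on the convex set {U ∈ ℝ⁸ : ρ(U) > 0}; that is, for all states U, Ũ ∈ ℝ⁸ with positive first component and all λ ∈ [0,1], p(λU + (1−λ)Ũ) ≥ λ p(U) + (1−λ) p(Ũ). -/
/-- MHD pressure function of a conservative state `U = (ρ, m₁, m₂, m₃, B₁, B₂, B₃, E)`. -/
noncomputable def mhdPressure (γ : ℝ) (U : Fin 8 → ℝ) : ℝ :=
  (γ - 1) * (U 7 - (U 1 ^ 2 + U 2 ^ 2 + U 3 ^ 2) / (2 * U 0)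
    - (U 4 ^ 2 + U 5 ^ 2 + U 6 ^ 2) / 2)

theorem mhd_aux_quot (a b r s l : ℝ) (hr : 0 < r) (hs : 0 < s) (h0 : 0 ≤ l) (h1 : l ≤ 1) :
    (l * a + (1 - l) * b) ^ 2 / (2 * (l * r + (1 - l) * s)) ≤
      l * (a ^ 2 / (2 * r)) + (1 - l) * (b ^ 2 / (2 * s)) := by
  have hd : 0 < l * r + (1 - l) * s := by
    rcases h0.eq_or_lt with h | h
    · subst h; linarith
    · have := mul_pos h hr
      have := mul_nonneg (sub_nonneg.2 h1) hs.le
      linarith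
  have key : l * (a ^ 2 / (2 * r)) + (1 - l) * (b ^ 2 / (2 * s))
      - (l * a + (1 - l) * b) ^ 2 / (2 * (l * r + (1 - l) * s))
      = l * (1 - l) * (a * s - b * r) ^ 2 / (2 * r * s * (l * r + (1 - l) * s)) := by
    have := hd.ne'
    field_simp
    ring
  have h2 : 0 ≤ 1 - l := sub_nonneg.2 h1
  have : 0 ≤ l * (1 - l) * (a * s - b * r) ^ 2 / (2 * r * s * (l * r + (1 - l) * s)) := by
    positivity
  linarith

theorem mhd_aux_sq (a b l : ℝ) (h0 : 0 ≤ l) (h1 : l ≤ 1) :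
    (l * a + (1 - l) * b) ^ 2 ≤ l * a ^ 2 + (1 - l) * b ^ 2 := by
  nlinarith [mul_nonneg (mul_nonneg h0 (sub_nonneg.2 h1)) (sq_nonneg (a - b))]

/-- For any adiabatic index γ > 1, the MHD pressure is concave on `{U : ρ(U) > 0}`. -/
theorem mhd_pressure_concave (γ : ℝ) (hγ : 1 < γ)
    (U V : Fin 8 → ℝ) (hU : 0 < U 0) (hV : 0 < V 0)
    (lam : ℝ) (hlam : lam ∈ Set.Icc (0 : ℝ) 1) :
    lam * mhdPressure γ U + (1 - lam) * mhdPressure γ V ≤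
      mhdPressure γ (lam • U + (1 - lam) • V) := by
  obtain ⟨h0, h1⟩ := hlam
  have q := fun i => mhd_aux_quot (U i) (V i) (U 0) (V 0) lam hU hV h0 h1
  have t := fun i => mhd_aux_sq (U i) (V i) lam h0 h1
  have q1 := q 1
  have q2 := q 2
  have q3 := q 3
  have t4 := t 4
  have t5 := t 5
  have t6 := t 6
  simp only [mhdPressure, Pi.add_apply, Pi.smul_apply, smul_eq_mul, add_div] at *
  have hg : 0 ≤ γ - 1 := by linarith
  refine le_trans (le_of_eq ?_) (mul_le_mul_of_nonneg_left
    (b := lam * (U 7 - (U 1 ^ 2 / (2 * U 0) + U 2 ^ 2 / (2 * U 0) + U 3 ^ 2 / (2 * U 0))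
      - (U 4 ^ 2 / 2 + U 5 ^ 2 / 2 + U 6 ^ 2 / 2)) +
      (1 - lam) * (V 7 - (V 1 ^ 2 / (2 * V 0) + V 2 ^ 2 / (2 * V 0) + V 3 ^ 2 / (2 * V 0))
      - (V 4 ^ 2 / 2 + V 5 ^ 2 / 2 + V 6 ^ 2 / 2))) ?_ hg)
  · ring
  · linarith
end

section
/- For any adiabatic index γ > 1, the admissible state set 𝒢 = {U ∈ ℝ⁸ : ρ(U) > 0 and p(U) > 0} is a convex subset of ℝ⁸. -/
theorem mhd_quad_aux (r s x y a b : ℝ) (hr : 0 < r) (hs : 0 < s) (ht : 0 < a * r + b * s)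
    (ha : 0 ≤ a) (hb : 0 ≤ b) :
    (a * x + b * y) ^ 2 / (2 * (a * r + b * s))
      ≤ a * (x ^ 2 / (2 * r)) + b * (y ^ 2 / (2 * s)) := by
  have key : ∀ (q z v : ℝ), 0 < q → z * v - q * v ^ 2 / 2 ≤ z ^ 2 / (2 * q) := by
    intro q z v hq
    rw [le_div_iff₀ (by positivity)]
    nlinarith [sq_nonneg (z - q * v)]
  have h1 := mul_le_mul_of_nonneg_left (key r x ((a * x + b * y) / (a * r + b * s)) hr) ha
  have h2 := mul_le_mul_of_nonneg_left (key s y ((a * x + b * y) / (a * r + b * s)) hs) hb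
  have h3 : (a * x + b * y) ^ 2 / (2 * (a * r + b * s))
      = (a * x + b * y) * ((a * x + b * y) / (a * r + b * s))
        - (a * r + b * s) * ((a * x + b * y) / (a * r + b * s)) ^ 2 / 2 := by
    field_simp
    ring
  rw [h3]
  linarith

theorem mhd_sq_aux (x y a b : ℝ) (ha : 0 ≤ a) (hb : 0 ≤ b) (hab : a + b = 1) :
    (a * x + b * y) ^ 2 ≤ a * x ^ 2 + b * y ^ 2 := by
  obtain rfl : b = 1 - a := by linarith
  nlinarith [mul_nonneg (mul_nonneg ha hb) (sq_nonneg (x - y))]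

/-- For any adiabatic index γ > 1, the admissible state set
`𝒢 = {U ∈ ℝ⁸ : ρ(U) > 0 and p(U) > 0}` is convex. -/
theorem mhd_admissible_set_convex (γ : ℝ) (hγ : 1 < γ) :
    Convex ℝ {U : Fin 8 → ℝ | 0 < U 0 ∧ 0 < mhdPressure γ U} := by
  have hg : 0 < γ - 1 := by linarith
  rintro U ⟨hU0, hU⟩ V ⟨hV0, hV⟩ a b ha hb hab
  have ht : 0 < a * U 0 + b * V 0 := by
    rcases ha.eq_or_lt with h | h
    · have : b = 1 := by linarith
      subst h this
      linarith
    · have := mul_pos h hU0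
      have := mul_nonneg hb hV0.le
      linarith
  unfold mhdPressure at hU hV
  have hU' := pos_of_mul_pos_right hU hg.le
  have hV' := pos_of_mul_pos_right hV hg.le
  refine ⟨by simpa using ht, ?_⟩
  unfold mhdPressure
  refine mul_pos hg ?_
  simp only [Pi.add_apply, Pi.smul_apply, smul_eq_mul]
  have q1 := mhd_quad_aux (U 0) (V 0) (U 1) (V 1) a b hU0 hV0 ht ha hb
  have q2 := mhd_quad_aux (U 0) (V 0) (U 2) (V 2) a b hU0 hV0 ht ha hb
  have q3 := mhd_quad_aux (U 0) (V 0) (U 3) (V 3) a b hU0 hV0 ht ha hb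
  have s4 := mhd_sq_aux (U 4) (V 4) a b ha hb hab
  have s5 := mhd_sq_aux (U 5) (V 5) a b ha hb hab
  have s6 := mhd_sq_aux (U 6) (V 6) a b ha hb hab
  rw [add_div, add_div] at hU' hV' ⊢
  have hpos : ∀ P Q : ℝ, 0 < P → 0 < Q → 0 < a * P + b * Q := by
    intro P Q hP hQ
    rcases ha.eq_or_lt with h | h
    · have : b = 1 := by linarith
      subst h this
      linarith
    · have := mul_pos h hP
      have := mul_nonneg hb hQ.le
      linarith
  have := hpos _ _ hU' hV'
  linarith
end

section
/- Source-term limiting step: let γ > 1 and let U^{src}, U^{LLF} ∈ ℝ⁸ be two states with the same (positive) density component, and let 0 < ε_p ≤ p(U^{LLF}). Define θ = min{1, (p(U^{LLF}) − ε_p)/(p(U^{LLF}) − p(U^{src}))} if p(U^{src}) < ε_p and θ = 1 otherwise. Then θ ∈ [0,1] and the blended state U^{Lim,1} = θ U^{src} + (1−θ) U^{LLF} satisfies p(U^{Lim,1}) ≥ ε_p; in particular U^{Lim,1} has the same density as U^{LLF}. -/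
/-- Source-term limiting step: the blended state `θ U^{src} + (1−θ) U^{LLF}` with the
parametrized choice of `θ` has pressure at least `ε_p` and the same density as `U^{LLF}`. -/
theorem source_term_limiting (γ : ℝ) (hγ : 1 < γ)
    (Usrc Ullf : Fin 8 → ℝ)
    (hρeq : Usrc 0 = Ullf 0) (hρpos : 0 < Ullf 0)
    (εp : ℝ) (hεp : 0 < εp) (hεple : εp ≤ mhdPressure γ Ullf)
    (θ : ℝ)
    (hθdef : θ = if mhdPressure γ Usrc < εp then
        min 1 ((mhdPressure γ Ullf - εp) / (mhdPressure γ Ullf - mhdPressure γ Usrc))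
      else 1) :
    θ ∈ Set.Icc (0 : ℝ) 1 ∧
      εp ≤ mhdPressure γ (θ • Usrc + (1 - θ) • Ullf) ∧
      (θ • Usrc + (1 - θ) • Ullf) 0 = Ullf 0 := by
  have hθ : θ ∈ Set.Icc (0 : ℝ) 1 ∧
      εp ≤ θ * mhdPressure γ Usrc + (1 - θ) * mhdPressure γ Ullf := by
    split_ifs at hθdef with h
    · have hd : 0 < mhdPressure γ Ullf - mhdPressure γ Usrc := by linarith
      have h0 : 0 ≤ θ := by
        rw [hθdef]
        exact le_min zero_le_one (div_nonneg (by linarith) hd.le)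
      have h1 : θ ≤ 1 := by
        rw [hθdef]
        exact min_le_left _ _
      have h2 : θ ≤ (mhdPressure γ Ullf - εp) / (mhdPressure γ Ullf - mhdPressure γ Usrc) := by
        rw [hθdef]
        exact min_le_right _ _
      rw [le_div_iff₀ hd] at h2
      exact ⟨⟨h0, h1⟩, by linarith⟩
    · subst hθdef
      refine ⟨⟨zero_le_one, le_refl _⟩, ?_⟩
      linarith
  obtain ⟨⟨h0, h1⟩, hc⟩ := hθ
  have hρ : (θ • Usrc + (1 - θ) • Ullf) 0 = Ullf 0 := by
    simp only [Pi.add_apply, Pi.smul_apply, smul_eq_mul, hρeq]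
    ring
  refine ⟨⟨h0, h1⟩, hc.trans ?_, hρ⟩
  have key : mhdPressure γ (θ • Usrc + (1 - θ) • Ullf) =
      θ * mhdPressure γ Usrc + (1 - θ) * mhdPressure γ Ullf
      + (γ - 1) * (θ * (1 - θ)) *
        (((Usrc 1 - Ullf 1) ^ 2 + (Usrc 2 - Ullf 2) ^ 2 + (Usrc 3 - Ullf 3) ^ 2) / (2 * Ullf 0)
        + ((Usrc 4 - Ullf 4) ^ 2 + (Usrc 5 - Ullf 5) ^ 2 + (Usrc 6 - Ullf 6) ^ 2) / 2) := by
    unfold mhdPressure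
    rw [hρ, hρeq]
    simp only [Pi.add_apply, Pi.smul_apply, smul_eq_mul]
    ring
  rw [key]
  have a : 0 ≤ γ - 1 := by linarith
  have b : 0 ≤ 1 - θ := by linarith
  have c := mul_nonneg (mul_nonneg a (mul_nonneg h0 b)) (show 0 ≤
    (((Usrc 1 - Ullf 1) ^ 2 + (Usrc 2 - Ullf 2) ^ 2 + (Usrc 3 - Ullf 3) ^ 2) / (2 * Ullf 0)
        + ((Usrc 4 - Ullf 4) ^ 2 + (Usrc 5 - Ullf 5) ^ 2 + (Usrc 6 - Ullf 6) ^ 2) / 2) by positivity)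
  linarith
end

section
/- Density flux-limiting rectangle lemma: let ε, δ, a ∈ ℝ with δ > 0 and a ≥ ε, and let h_L, h_R, h_D, h_U ∈ ℝ. For each index I ∈ {L,R,D,U} define Λ_I = min{1, (a − ε)/(δ − Σ_{J : h_J < 0} h_J)} if h_I < 0, and Λ_I = 1 otherwise. Then for all θ_L ∈ [0,Λ_L], θ_R ∈ [0,Λ_R], θ_D ∈ [0,Λ_D], θ_U ∈ [0,Λ_U], one has a + θ_L h_L + θ_R h_R + θ_D h_D + θ_U h_U ≥ ε. -/
/-- Density flux-limiting rectangle lemma: the rectangle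
`[0,Λ_L]×[0,Λ_R]×[0,Λ_D]×[0,Λ_U]` built from the parametrized limiter keeps the
limited density `a + Σ θ_I h_I` above the lower bound `ε`. -/
theorem density_flux_limiting_rectangle
    (ε δ a : ℝ) (hδ : 0 < δ) (ha : ε ≤ a)
    (hL hR hD hU : ℝ)
    (negSum : ℝ)
    (hnegSum : negSum = (if hL < 0 then hL else 0) + (if hR < 0 then hR else 0)
      + (if hD < 0 then hD else 0) + (if hU < 0 then hU else 0))
    (ΛL ΛR ΛD ΛU : ℝ)
    (hΛL : ΛL = if hL < 0 then min 1 ((a - ε) / (δ - negSum)) else 1)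
    (hΛR : ΛR = if hR < 0 then min 1 ((a - ε) / (δ - negSum)) else 1)
    (hΛD : ΛD = if hD < 0 then min 1 ((a - ε) / (δ - negSum)) else 1)
    (hΛU : ΛU = if hU < 0 then min 1 ((a - ε) / (δ - negSum)) else 1)
    (θL θR θD θU : ℝ)
    (hθL : θL ∈ Set.Icc 0 ΛL) (hθR : θR ∈ Set.Icc 0 ΛR)
    (hθD : θD ∈ Set.Icc 0 ΛD) (hθU : θU ∈ Set.Icc 0 ΛU) :
    ε ≤ a + θL * hL + θR * hR + θD * hD + θU * hU := by
  have key : ∀ h Λ θ q : ℝ, Λ = (if h < 0 then min 1 q else 1) → θ ∈ Set.Icc 0 Λ →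
      q * (if h < 0 then h else 0) ≤ θ * h := by
    intro h Λ θ q hΛ hθ
    obtain ⟨h0, h1⟩ := hθ
    by_cases hh : h < 0
    · rw [if_pos hh] at hΛ ⊢
      have : θ ≤ q := by rw [hΛ] at h1; exact h1.trans (min_le_right _ _)
      nlinarith
    · rw [if_neg hh]
      have := mul_nonneg h0 (not_lt.mp hh)
      linarith
  have hle : ∀ h : ℝ, (if h < 0 then h else 0) ≤ 0 := by
    intro h
    split_ifs with hh
    · exact hh.le
    · exact le_rfl
  have hpos : 0 < δ - negSum := by
    linarith [hle hL, hle hR, hle hD, hle hU]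
  have k1 := key _ _ _ _ hΛL hθL
  have k2 := key _ _ _ _ hΛR hθR
  have k3 := key _ _ _ _ hΛD hθD
  have k4 := key _ _ _ _ hΛU hθU
  have hq : 0 ≤ (a - ε) / (δ - negSum) := div_nonneg (by linarith) hpos.le
  have hm : (a - ε) / (δ - negSum) * (δ - negSum) = a - ε := div_mul_cancel₀ _ hpos.ne'
  generalize (a - ε) / (δ - negSum) = q at *
  have hs : q * negSum = q * (if hL < 0 then hL else 0) + q * (if hR < 0 then hR else 0)
      + q * (if hD < 0 then hD else 0) + q * (if hU < 0 then hU else 0) := by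
    rw [hnegSum]; ring
  have hqd := mul_nonneg hq hδ.le
  rw [mul_sub] at hm
  linarith
end

section
/- Convexity of the admissible parameter set: let γ > 1, let U ∈ ℝ⁸ and H_L, H_R, H_D, H_U ∈ ℝ⁸, and let ε_ρ, ε_p > 0. Then the set S_p = { (θ_L, θ_R, θ_D, θ_U) ∈ [0,1]⁴ : ρ(U + θ_L H_L + θ_R H_R + θ_D H_D + θ_U H_U) ≥ ε_ρ and p(U + θ_L H_L + θ_R H_R + θ_D H_D + θ_U H_U) ≥ ε_p } is a convex subset of ℝ⁴, where ρ(·) denotes the first component. Likewise the set S_ρ defined by the density condition alone is convex. -/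
lemma quad_over_lin (a b x y r s : ℝ) (ha : 0 ≤ a) (hb : 0 ≤ b) (hab : a + b = 1)
    (hr : 0 < r) (hs : 0 < s) :
    (a * x + b * y) ^ 2 / (2 * (a * r + b * s)) ≤ a * (x ^ 2 / (2 * r)) + b * (y ^ 2 / (2 * s)) := by
  have hd : 0 < a * r + b * s := by
    rcases ha.eq_or_lt with h | h
    · have : b = 1 := by linarith
      subst this; rw [← h]; linarith
    · have := mul_pos h hr
      have := mul_nonneg hb hs.le
      linarith
  rw [div_le_iff₀ (by linarith)]
  have key : (a * (x ^ 2 / (2 * r)) + b * (y ^ 2 / (2 * s))) * (2 * (a * r + b * s))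
      - (a * x + b * y) ^ 2 = a * b * (x * s - y * r) ^ 2 / (r * s) := by
    field_simp
    ring
  have : 0 ≤ a * b * (x * s - y * r) ^ 2 / (r * s) := by positivity
  linarith

lemma sq_cvx (a b x y : ℝ) (ha : 0 ≤ a) (hb : 0 ≤ b) (hab : a + b = 1) :
    (a * x + b * y) ^ 2 ≤ a * x ^ 2 + b * y ^ 2 := by
  have : b = 1 - a := by linarith
  subst this
  nlinarith [mul_nonneg (mul_nonneg ha hb) (sq_nonneg (x - y))]

lemma mhdPressure_concave (γ : ℝ) (hγ : 1 < γ) (V W : Fin 8 → ℝ) (a b : ℝ)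
    (ha : 0 ≤ a) (hb : 0 ≤ b) (hab : a + b = 1) (hV : 0 < V 0) (hW : 0 < W 0) :
    a * mhdPressure γ V + b * mhdPressure γ W ≤ mhdPressure γ (a • V + b • W) := by
  simp only [mhdPressure, Pi.add_apply, Pi.smul_apply, smul_eq_mul]
  have h1 := quad_over_lin a b (V 1) (W 1) _ _ ha hb hab hV hW
  have h2 := quad_over_lin a b (V 2) (W 2) _ _ ha hb hab hV hW
  have h3 := quad_over_lin a b (V 3) (W 3) _ _ ha hb hab hV hW
  have h4 := sq_cvx a b (V 4) (W 4) ha hb hab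
  have h5 := sq_cvx a b (V 5) (W 5) ha hb hab
  have h6 := sq_cvx a b (V 6) (W 6) ha hb hab
  simp only [add_div]
  rw [mul_left_comm a, mul_left_comm b, ← mul_add]
  apply mul_le_mul_of_nonneg_left _ (by linarith)
  linarith

lemma state_affine (U : Fin 8 → ℝ) (H : Fin 4 → Fin 8 → ℝ) (x y : Fin 4 → ℝ) (a b : ℝ)
    (hab : a + b = 1) :
    U + ∑ i, (a • x + b • y) i • H i = a • (U + ∑ i, x i • H i) + b • (U + ∑ i, y i • H i) := by
  have : b = 1 - a := by linarith
  subst this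
  ext j
  simp [Fin.sum_univ_four]
  ring

lemma le_comb (e a b u v : ℝ) (ha : 0 ≤ a) (hb : 0 ≤ b) (hab : a + b = 1)
    (hu : e ≤ u) (hv : e ≤ v) : e ≤ a * u + b * v := by
  have h1 := mul_le_mul_of_nonneg_left hu ha
  have h2 := mul_le_mul_of_nonneg_left hv hb
  have : a * e + b * e = e := by rw [← add_mul, hab, one_mul]
  linarith

/-- Convexity of the admissible parameter sets `S_p` and `S_ρ` for the parametrized
flux limiter: the set of blending parameters `(θ_L, θ_R, θ_D, θ_U) ∈ [0,1]⁴` for which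
the limited state satisfies the density (and pressure) lower bounds is convex. -/
theorem limiter_parameter_sets_convex (γ : ℝ) (hγ : 1 < γ)
    (U : Fin 8 → ℝ) (H : Fin 4 → Fin 8 → ℝ)
    (ερ εp : ℝ) (hερ : 0 < ερ) (hεp : 0 < εp) :
    Convex ℝ {θ : Fin 4 → ℝ | (∀ i, θ i ∈ Set.Icc (0 : ℝ) 1) ∧
        ερ ≤ (U + ∑ i, θ i • H i) 0 ∧
        εp ≤ mhdPressure γ (U + ∑ i, θ i • H i)} ∧
    Convex ℝ {θ : Fin 4 → ℝ | (∀ i, θ i ∈ Set.Icc (0 : ℝ) 1) ∧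
        ερ ≤ (U + ∑ i, θ i • H i) 0} := by
  constructor
  · rintro x ⟨hx, hx0, hxp⟩ y ⟨hy, hy0, hyp⟩ a b ha hb hab
    refine ⟨fun i => convex_Icc (0 : ℝ) 1 (hx i) (hy i) ha hb hab, ?_, ?_⟩
    · rw [state_affine U H x y a b hab]
      exact le_comb _ a b _ _ ha hb hab hx0 hy0
    · rw [state_affine U H x y a b hab]
      exact (le_comb _ a b _ _ ha hb hab hxp hyp).trans
        (mhdPressure_concave γ hγ _ _ a b ha hb hab (hερ.trans_le hx0) (hερ.trans_le hy0))
  · rintro x ⟨hx, hx0⟩ y ⟨hy, hy0⟩ a b ha hb hab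
    refine ⟨fun i => convex_Icc (0 : ℝ) 1 (hx i) (hy i) ha hb hab, ?_⟩
    rw [state_affine U H x y a b hab]
    exact le_comb _ a b _ _ ha hb hab hx0 hy0
end

section
/- Scaling limiter, pressure step: let γ > 1 and let U*, U^{LLF} ∈ ℝ⁸ be states with positive density components, and let 0 < ε_p ≤ p(U^{LLF}). Define θ** = (p(U^{LLF}) − ε_p)/(p(U^{LLF}) − p(U*)) if p(U*) < ε_p and θ** = 1 otherwise. Then θ** ∈ [0,1] and the blended state U^{Lim} = θ** U* + (1−θ**) U^{LLF} satisfies p(U^{Lim}) ≥ ε_p. -/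
theorem qol_aux (t s a b r q : ℝ) (ht : 0 ≤ t) (hs : 0 ≤ s) (hr : 0 < r) (hq : 0 < q)
    (h : 0 < t * r + s * q) :
    (t * a + s * b) ^ 2 / (2 * (t * r + s * q)) ≤ t * (a ^ 2 / (2 * r)) + s * (b ^ 2 / (2 * q)) := by
  have key : t * (a ^ 2 / (2 * r)) + s * (b ^ 2 / (2 * q))
      - (t * a + s * b) ^ 2 / (2 * (t * r + s * q))
      = t * s * (a * q - b * r) ^ 2 / (2 * r * q * (t * r + s * q)) := by
    have := h.ne'
    field_simp
    ring
  have : 0 ≤ t * s * (a * q - b * r) ^ 2 / (2 * r * q * (t * r + s * q)) := by positivity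
  linarith

theorem sq_aux (t a b : ℝ) (ht : 0 ≤ t) (hs : 0 ≤ 1 - t) :
    (t * a + (1 - t) * b) ^ 2 ≤ t * a ^ 2 + (1 - t) * b ^ 2 := by
  nlinarith [mul_nonneg (mul_nonneg ht hs) (sq_nonneg (a - b))]

theorem pressure_concave_aux (γ : ℝ) (hγ : 1 < γ) (U V : Fin 8 → ℝ) (hU : 0 < U 0) (hV : 0 < V 0)
    (t : ℝ) (ht : 0 ≤ t) (hs : 0 ≤ 1 - t) :
    t * mhdPressure γ U + (1 - t) * mhdPressure γ V ≤ mhdPressure γ (t • U + (1 - t) • V) := by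
  have h : 0 < t * U 0 + (1 - t) * V 0 := by
    rcases ht.eq_or_lt with h0 | h0
    · subst h0; simpa using hV
    · have := mul_pos h0 hU
      have := mul_nonneg hs hV.le
      linarith
  have q := fun i => qol_aux t (1 - t) (U i) (V i) (U 0) (V 0) ht hs hU hV h
  have r := fun i => sq_aux t (U i) (V i) ht hs
  simp only [mhdPressure, Pi.add_apply, Pi.smul_apply, smul_eq_mul, add_div] 
  have hg : 0 ≤ γ - 1 := by linarith
  rw [mul_left_comm, mul_left_comm (1 - t), ← mul_add]
  apply mul_le_mul_of_nonneg_left _ hg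
  linarith [q 1, q 2, q 3, r 4, r 5, r 6]

/-- Scaling limiter, pressure step: the blending parameter `θ**` lies in `[0,1]` and the
blended state `θ** U* + (1−θ**) U^{LLF}` has pressure at least `ε_p`. -/
theorem scaling_limiter_pressure (γ : ℝ) (hγ : 1 < γ)
    (Ustar Ullf : Fin 8 → ℝ)
    (hρstar : 0 < Ustar 0) (hρllf : 0 < Ullf 0)
    (εp : ℝ) (hεp : 0 < εp) (hεple : εp ≤ mhdPressure γ Ullf)
    (θ : ℝ)
    (hθdef : θ = if mhdPressure γ Ustar < εp then
        (mhdPressure γ Ullf - εp) / (mhdPressure γ Ullf - mhdPressure γ Ustar)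
      else 1) :
    θ ∈ Set.Icc (0 : ℝ) 1 ∧ εp ≤ mhdPressure γ (θ • Ustar + (1 - θ) • Ullf) := by
  by_cases hc : mhdPressure γ Ustar < εp
  · rw [if_pos hc] at hθdef
    have hd : 0 < mhdPressure γ Ullf - mhdPressure γ Ustar := by linarith
    have h0 : 0 ≤ θ := by rw [hθdef]; exact div_nonneg (by linarith) hd.le
    have h1 : θ ≤ 1 := by rw [hθdef, div_le_one hd]; linarith
    have he : θ * (mhdPressure γ Ullf - mhdPressure γ Ustar) = mhdPressure γ Ullf - εp := by
      rw [hθdef]; exact div_mul_cancel₀ _ hd.ne'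
    refine ⟨⟨h0, h1⟩, ?_⟩
    have := pressure_concave_aux γ hγ Ustar Ullf hρstar hρllf θ h0 (by linarith)
    linarith
  · rw [if_neg hc] at hθdef
    subst hθdef
    refine ⟨by simp, ?_⟩
    simpa using hc
end

section
/- Cell-center value of the bi-parabolic reconstruction: let u(x,y) = Σ_{0 ≤ k,l ≤ 2} a_{kl} x^k y^l be a polynomial of degree at most 2 in each variable, let Δx, Δy > 0, and consider the cell I = [x₀ − Δx/2, x₀ + Δx/2] × [y₀ − Δy/2, y₀ + Δy/2] with center (x₀, y₀). Let ū = (1/(ΔxΔy)) ∫∫_I u dx dy be the cell average, let u_W, u_E, u_S, u_N be the values of u at the four edge midpoints (x₀ ∓ Δx/2, y₀) and (x₀, y₀ ∓ Δy/2), and let u_{SW}, u_{SE}, u_{NW}, u_{NE} be the values at the four corners. Then u(x₀, y₀) = (1/16)[ 36 ū − 4(u_W + u_E + u_S + u_N) − (u_{SW} + u_{SE} + u_{NW} + u_{NE}) ]. -/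
open intervalIntegral

lemma simpson_quad (a b c x0 d : ℝ) (f : ℝ → ℝ) (hf : ∀ x, f x = a + b * x + c * x ^ 2) :
    ∫ x in (x0 - d / 2)..(x0 + d / 2), f x
      = d / 6 * (f (x0 - d / 2) + 4 * f x0 + f (x0 + d / 2)) := by
  have h : ∀ x ∈ Set.uIcc (x0 - d / 2) (x0 + d / 2),
      HasDerivAt (fun x => a * x + b * (x ^ 2 / 2) + c * (x ^ 3 / 3)) (f x) x := by
    intro x _
    have h2 := ((hasDerivAt_pow 2 x).div_const 2).const_mul b
    have h3 := ((hasDerivAt_pow 3 x).div_const 3).const_mul c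
    have h1 := (hasDerivAt_id x).const_mul a
    refine ((h1.add h2).add h3).congr_deriv ?_
    rw [hf]
    push_cast
    ring
  have hc : Continuous f := by
    rw [show f = fun x => a + b * x + c * x ^ 2 from funext hf]
    fun_prop
  rw [integral_eq_sub_of_hasDerivAt h (hc.intervalIntegrable _ _)]
  simp only [hf]
  ring

/-- Cell-center value of the bi-parabolic reconstruction: for a polynomial of degree at
most 2 in each variable, the value at the cell center is recovered from the cell average,
the four edge-midpoint values and the four corner values by the stated formula. -/
theorem biparabolic_cell_center_formula
    (A : Fin 3 → Fin 3 → ℝ) (u : ℝ → ℝ → ℝ)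
    (hu : u = fun x y => ∑ k : Fin 3, ∑ l : Fin 3, A k l * x ^ (k : ℕ) * y ^ (l : ℕ))
    (Δx Δy : ℝ) (hΔx : 0 < Δx) (hΔy : 0 < Δy) (x0 y0 : ℝ)
    (ubar : ℝ)
    (hubar : ubar = (1 / (Δx * Δy)) *
      ∫ x in (x0 - Δx / 2)..(x0 + Δx / 2), ∫ y in (y0 - Δy / 2)..(y0 + Δy / 2), u x y) :
    u x0 y0 = (1 / 16) * (36 * ubar
      - 4 * (u (x0 - Δx / 2) y0 + u (x0 + Δx / 2) y0
           + u x0 (y0 - Δy / 2) + u x0 (y0 + Δy / 2))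
      - (u (x0 - Δx / 2) (y0 - Δy / 2) + u (x0 + Δx / 2) (y0 - Δy / 2)
       + u (x0 - Δx / 2) (y0 + Δy / 2) + u (x0 + Δx / 2) (y0 + Δy / 2))) := by
  have hy : ∀ x, ∫ y in (y0 - Δy / 2)..(y0 + Δy / 2), u x y
      = Δy / 6 * (u x (y0 - Δy / 2) + 4 * u x y0 + u x (y0 + Δy / 2)) := by
    intro x
    refine simpson_quad (A 0 0 + A 1 0 * x + A 2 0 * x ^ 2) (A 0 1 + A 1 1 * x + A 2 1 * x ^ 2)
      (A 0 2 + A 1 2 * x + A 2 2 * x ^ 2) y0 Δy (u x) ?_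
    intro y
    simp only [hu, Fin.sum_univ_three, Fin.val_zero, Fin.val_one, Fin.val_two]
    ring
  let B : Fin 3 → ℝ → ℝ := fun k y => A k 0 + A k 1 * y + A k 2 * y ^ 2
  let C : Fin 3 → ℝ := fun k =>
    Δy / 6 * (B k (y0 - Δy / 2) + 4 * B k y0 + B k (y0 + Δy / 2))
  have hx := simpson_quad (C 0) (C 1) (C 2) x0 Δx
    (fun x => Δy / 6 * (u x (y0 - Δy / 2) + 4 * u x y0 + u x (y0 + Δy / 2))) (by
      intro x
      simp only [C, B, hu, Fin.sum_univ_three, Fin.val_zero, Fin.val_one, Fin.val_two]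
      ring)
  simp only [hy] at hubar
  rw [hx] at hubar
  rw [hubar]
  clear hx hy hubar hu
  field_simp
  ring
end

section
/- Transport of the relative divergence: let ρ, v₁, v₂, B₁, B₂ : ℝ³ → ℝ be C² functions of (t, x, y) with ρ > 0 everywhere, satisfying the continuity equation ∂_t ρ + ∂_x(ρ v₁) + ∂_y(ρ v₂) = 0 and the induction equations ∂_t B₁ + ∂_y(v₂B₁ − B₂v₁) = −(∂_x B₁ + ∂_y B₂) v₁ and ∂_t B₂ + ∂_x(v₁B₂ − B₁v₂) = −(∂_x B₁ + ∂_y B₂) v₂. Then, with d := ∂_x B₁ + ∂_y B₂, the quantity d/ρ satisfies the transport equation ∂_t(d/ρ) + v₁ ∂_x(d/ρ) + v₂ ∂_y(d/ρ) = 0 everywhere. -/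
lemma c2_aux1 (f : ℝ × ℝ × ℝ → ℝ) (hf : Differentiable ℝ f) (t x y : ℝ) :
    HasDerivAt (fun s => f (s, x, y)) (fderiv ℝ f (t, x, y) (1, 0, 0)) t ∧
    HasDerivAt (fun s => f (t, s, y)) (fderiv ℝ f (t, x, y) (0, 1, 0)) x ∧
    HasDerivAt (fun s => f (t, x, s)) (fderiv ℝ f (t, x, y) (0, 0, 1)) y := by
  have h := (hf (t, x, y)).hasFDerivAt
  refine ⟨?_, ?_, ?_⟩
  · exact h.comp_hasDerivAt t
      ((hasDerivAt_id t).prodMk ((hasDerivAt_const t x).prodMk (hasDerivAt_const t y)))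
  · exact h.comp_hasDerivAt x
      ((hasDerivAt_const x t).prodMk ((hasDerivAt_id x).prodMk (hasDerivAt_const x y)))
  · exact h.comp_hasDerivAt y
      ((hasDerivAt_const y t).prodMk ((hasDerivAt_const y x).prodMk (hasDerivAt_id y)))

lemma c2_aux2 (f : ℝ × ℝ × ℝ → ℝ) (hf : ContDiff ℝ 2 f) (u : ℝ × ℝ × ℝ) :
    Differentiable ℝ (fun q => fderiv ℝ f q u) ∧
    ∀ q w, fderiv ℝ (fun q => fderiv ℝ f q u) q w = fderiv ℝ (fun q => fderiv ℝ f q w) q u := by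
  have h1 : ContDiff ℝ 1 (fderiv ℝ f) := hf.fderiv_right (by norm_num)
  have h2 : Differentiable ℝ (fderiv ℝ f) := h1.differentiable (by norm_num)
  have key : ∀ u q w, fderiv ℝ (fun q => fderiv ℝ f q u) q w = fderiv ℝ (fderiv ℝ f) q w u := by
    intro u q w
    have := ((h2 q).hasFDerivAt.clm_apply (hasFDerivAt_const u q)).fderiv
    rw [this]; simp
  refine ⟨fun q => (h2 q).clm_apply (differentiableAt_const u), fun q w => ?_⟩
  rw [key, key]
  exact (hf.contDiffAt.isSymmSndFDerivAt (by simp)) w u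

lemma c2_aux (f : ℝ → ℝ → ℝ → ℝ)
    (hf : ContDiff ℝ 2 (fun q : ℝ × ℝ × ℝ => f q.1 q.2.1 q.2.2)) :
    ∃ ft fx fy ftx fty fxx fxy fyy : ℝ → ℝ → ℝ → ℝ, ∀ t x y,
      HasDerivAt (fun s => f s x y) (ft t x y) t ∧
      HasDerivAt (fun s => f t s y) (fx t x y) x ∧
      HasDerivAt (fun s => f t x s) (fy t x y) y ∧
      HasDerivAt (fun s => ft t s y) (ftx t x y) x ∧
      HasDerivAt (fun s => ft t x s) (fty t x y) y ∧
      HasDerivAt (fun s => fx s x y) (ftx t x y) t ∧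
      HasDerivAt (fun s => fx t s y) (fxx t x y) x ∧
      HasDerivAt (fun s => fx t x s) (fxy t x y) y ∧
      HasDerivAt (fun s => fy s x y) (fty t x y) t ∧
      HasDerivAt (fun s => fy t s y) (fxy t x y) x ∧
      HasDerivAt (fun s => fy t x s) (fyy t x y) y := by
  set F := fun q : ℝ × ℝ × ℝ => f q.1 q.2.1 q.2.2 with hF
  let D : ℝ × ℝ × ℝ → ℝ × ℝ × ℝ → ℝ := fun u q => fderiv ℝ F q u
  let D2 : ℝ × ℝ × ℝ → ℝ × ℝ × ℝ → ℝ × ℝ × ℝ → ℝ := fun u w q => fderiv ℝ (D u) q w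
  have sym : ∀ u w q, D2 u w q = D2 w u q := fun u w q => (c2_aux2 F hf u).2 q w
  have dd : ∀ u, Differentiable ℝ (D u) := fun u => (c2_aux2 F hf u).1
  refine ⟨fun t x y => D (1,0,0) (t,x,y), fun t x y => D (0,1,0) (t,x,y),
    fun t x y => D (0,0,1) (t,x,y), fun t x y => D2 (1,0,0) (0,1,0) (t,x,y),
    fun t x y => D2 (1,0,0) (0,0,1) (t,x,y), fun t x y => D2 (0,1,0) (0,1,0) (t,x,y),
    fun t x y => D2 (0,1,0) (0,0,1) (t,x,y), fun t x y => D2 (0,0,1) (0,0,1) (t,x,y), ?_⟩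
  intro t x y
  obtain ⟨a1, a2, a3⟩ := c2_aux1 F (hf.differentiable (by norm_num)) t x y
  obtain ⟨b1, b2, b3⟩ := c2_aux1 _ (dd (1,0,0)) t x y
  obtain ⟨c1, c2, c3⟩ := c2_aux1 _ (dd (0,1,0)) t x y
  obtain ⟨d1, d2, d3⟩ := c2_aux1 _ (dd (0,0,1)) t x y
  refine ⟨a1, a2, a3, b2, b3, ?_, c2, c3, ?_, ?_, d3⟩
  · exact c1.congr_deriv (sym (0,1,0) (1,0,0) (t,x,y))
  · exact d1.congr_deriv (sym (0,0,1) (1,0,0) (t,x,y))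
  · exact d2.congr_deriv (sym (0,0,1) (0,1,0) (t,x,y))

/-- Transport of the relative divergence: if `ρ, v, B` satisfy the continuity equation
and the Godunov–Powell induction equations (with C² data and `ρ > 0`), then
`d/ρ` with `d = ∂_x B₁ + ∂_y B₂` satisfies the transport equation
`∂_t(d/ρ) + v₁ ∂_x(d/ρ) + v₂ ∂_y(d/ρ) = 0`. -/
theorem relative_divergence_transport
    (ρ v1 v2 B1 B2 : ℝ → ℝ → ℝ → ℝ)
    (hρ : ContDiff ℝ 2 (fun q : ℝ × ℝ × ℝ => ρ q.1 q.2.1 q.2.2))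
    (hv1 : ContDiff ℝ 2 (fun q : ℝ × ℝ × ℝ => v1 q.1 q.2.1 q.2.2))
    (hv2 : ContDiff ℝ 2 (fun q : ℝ × ℝ × ℝ => v2 q.1 q.2.1 q.2.2))
    (hB1 : ContDiff ℝ 2 (fun q : ℝ × ℝ × ℝ => B1 q.1 q.2.1 q.2.2))
    (hB2 : ContDiff ℝ 2 (fun q : ℝ × ℝ × ℝ => B2 q.1 q.2.1 q.2.2))
    (hρpos : ∀ t x y : ℝ, 0 < ρ t x y)
    (hcont : ∀ t x y : ℝ,
      deriv (fun s => ρ s x y) t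
        + deriv (fun x' => ρ t x' y * v1 t x' y) x
        + deriv (fun y' => ρ t x y' * v2 t x y') y = 0)
    (d : ℝ → ℝ → ℝ → ℝ)
    (hd : d = fun t x y =>
      deriv (fun x' => B1 t x' y) x + deriv (fun y' => B2 t x y') y)
    (hind1 : ∀ t x y : ℝ,
      deriv (fun s => B1 s x y) t
        + deriv (fun y' => v2 t x y' * B1 t x y' - B2 t x y' * v1 t x y') y
      = -(d t x y) * v1 t x y)
    (hind2 : ∀ t x y : ℝ,
      deriv (fun s => B2 s x y) t
        + deriv (fun x' => v1 t x' y * B2 t x' y - B1 t x' y * v2 t x' y) x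
      = -(d t x y) * v2 t x y) :
    ∀ t x y : ℝ,
      deriv (fun s => d s x y / ρ s x y) t
        + v1 t x y * deriv (fun x' => d t x' y / ρ t x' y) x
        + v2 t x y * deriv (fun y' => d t x y' / ρ t x y') y = 0 := by
  obtain ⟨rt, rx, ry, _, _, _, _, _, hr⟩ := c2_aux ρ hρ
  obtain ⟨v1t, v1x, v1y, v1tx, v1ty, v1xx, v1xy, v1yy, h1⟩ := c2_aux v1 hv1
  obtain ⟨v2t, v2x, v2y, v2tx, v2ty, v2xx, v2xy, v2yy, h2⟩ := c2_aux v2 hv2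
  obtain ⟨at', ax, ay, atx, aty, axx, axy, ayy, ha⟩ := c2_aux B1 hB1
  obtain ⟨bt, bx, bby, btx, bty, bxx, bxy, byy, hb⟩ := c2_aux B2 hB2
  have hd' : d = fun t x y => ax t x y + bby t x y := by
    rw [hd]; funext t x y
    rw [(ha t x y).2.1.deriv, (hb t x y).2.2.1.deriv]
  clear hd
  subst hd'
  have e1 : ∀ t x y, at' t x y + v2y t x y * B1 t x y + v2 t x y * ay t x y
      - B2 t x y * v1y t x y + ax t x y * v1 t x y = 0 := by
    intro t x y
    have h := hind1 t x y
    obtain ⟨a1, a2, a3, -⟩ := ha t x y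
    obtain ⟨b1, b2, b3, -⟩ := hb t x y
    obtain ⟨c1, c2, c3, -⟩ := h1 t x y
    obtain ⟨d1, d2, d3, -⟩ := h2 t x y
    rw [a1.deriv, ((d3.fun_mul a3).fun_sub (b3.fun_mul c3)).deriv] at h
    linarith
  have e2 : ∀ t x y, bt t x y + v1x t x y * B2 t x y + v1 t x y * bx t x y
      - B1 t x y * v2x t x y + bby t x y * v2 t x y = 0 := by
    intro t x y
    have h := hind2 t x y
    obtain ⟨a1, a2, a3, -⟩ := ha t x y
    obtain ⟨b1, b2, b3, -⟩ := hb t x y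
    obtain ⟨c1, c2, c3, -⟩ := h1 t x y
    obtain ⟨d1, d2, d3, -⟩ := h2 t x y
    rw [b1.deriv, ((c2.fun_mul b2).fun_sub (a2.fun_mul d2)).deriv] at h
    linarith
  intro t x y
  have hc := hcont t x y
  have hp := (hρpos t x y).ne'
  obtain ⟨r1, r2, r3, -⟩ := hr t x y
  obtain ⟨a1, a2, a3, a4, a5, a6, a7, a8, a9, a10, a11⟩ := ha t x y
  obtain ⟨b1, b2, b3, b4, b5, b6, b7, b8, b9, b10, b11⟩ := hb t x y
  obtain ⟨c1, c2, c3, c4, c5, c6, c7, c8, c9, c10, c11⟩ := h1 t x y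
  obtain ⟨d1, d2, d3, d4, d5, d6, d7, d8, d9, d10, d11⟩ := h2 t x y
  rw [r1.deriv, (r2.fun_mul c2).deriv, (r3.fun_mul d3).deriv] at hc
  have E1 := ((((a4.fun_add (d10.fun_mul a2)).fun_add (d2.fun_mul a10)).fun_sub
    (b2.fun_mul c10)).fun_add (a7.fun_mul c2)).deriv
  have E2 := ((((b5.fun_add (c8.fun_mul b3)).fun_add (c3.fun_mul b8)).fun_sub
    (a3.fun_mul d8)).fun_add (b11.fun_mul d3)).deriv
  simp only [e1, e2, deriv_const] at E1 E2
  rw [((a6.fun_add b9).fun_div r1 hp).deriv, ((a7.fun_add b10).fun_div r2 hp).deriv,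
    ((a8.fun_add b11).fun_div r3 hp).deriv]
  field_simp
  linear_combination (-ρ t x y) * (E1 + E2) - (ax t x y + bby t x y) * hc
end
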